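/- Let g ≥ 1, let τ be a symmetric complex g×g matrix with positive definite imaginary part, let z ∈ ℂ^g, ε, δ ∈ ℤ^g and j ∈ Fin g. Then the function t ↦ θ[ε,δ](τ, z + t·e_j) (t ∈ ℂ, e_j the j-th standard basis vector) is differentiable at 0 with derivative equal to the termwise-differentiated series ∑_{m ∈ ℤ^g} 2πi·(m+ε/2)_j · exp(πi·((m+ε/2)·(τ(m+ε/2)) + 2(m+ε/2)·(z+δ/2))). -/

import Mathlib

open Matrix Complex

/-- The general term of the theta series with characteristic `[ε,δ]`. -/
noncomputable def thetaTerm (g : ℕ) (ε δ : Fin g → ℤ) (τ : Matrix (Fin g) (Fin g) ℂ)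
    (z : Fin g → ℂ) (m : Fin g → ℤ) : ℂ :=
  Complex.exp ((Real.pi : ℂ) * Complex.I *
    ((fun i => (m i : ℂ) + (ε i : ℂ) / 2) ⬝ᵥ (τ *ᵥ fun i => (m i : ℂ) + (ε i : ℂ) / 2)
      + 2 * ((fun i => (m i : ℂ) + (ε i : ℂ) / 2) ⬝ᵥ fun i => z i + (δ i : ℂ) / 2)))

/-- The theta function with characteristic `[ε,δ]`:
`θ[ε,δ](τ,z) = ∑_{m ∈ ℤ^g} exp(πi·((m+ε/2)·(τ(m+ε/2)) + 2(m+ε/2)·(z+δ/2)))`. -/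
noncomputable def thetaChar (g : ℕ) (ε δ : Fin g → ℤ) (τ : Matrix (Fin g) (Fin g) ℂ)
    (z : Fin g → ℂ) : ℂ :=
  ∑' m : Fin g → ℤ, thetaTerm g ε δ τ z m

/-- The quadratic form of a real positive definite matrix dominates a positive multiple of the
squared sup norm. -/
lemma Matrix.PosDef.exists_mul_sq_norm_le {ι : Type*} [Fintype ι] {Y : Matrix ι ι ℝ}
    (hY : Y.PosDef) : ∃ c : ℝ, 0 < c ∧ ∀ x : ι → ℝ, c * ‖x‖ ^ 2 ≤ x ⬝ᵥ (Y *ᵥ x) := by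
  have hcont : Continuous fun x : ι → ℝ => x ⬝ᵥ (Y *ᵥ x) := by fun_prop
  obtain ⟨c, hc, hle⟩ := (isCompact_sphere (0 : ι → ℝ) 1).exists_forall_le' hcont.continuousOn
    (a := 0) fun x hx => by
      have hx0 : x ≠ 0 := by
        rintro rfl
        simp at hx
      simpa using hY.dotProduct_mulVec_pos hx0
  refine ⟨c, hc, fun x => ?_⟩
  rcases eq_or_ne x 0 with rfl | hx
  · simp
  have hn : ‖x‖ ≠ 0 := norm_ne_zero_iff.mpr hx
  have h := hle (‖x‖⁻¹ • x) (by simp [norm_smul, hn])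
  rw [mulVec_smul, smul_dotProduct, dotProduct_smul, smul_eq_mul, smul_eq_mul, ← mul_assoc] at h
  calc c * ‖x‖ ^ 2 ≤ (‖x‖⁻¹ * ‖x‖⁻¹ * (x ⬝ᵥ (Y *ᵥ x))) * ‖x‖ ^ 2 := by gcongr
    _ = x ⬝ᵥ (Y *ᵥ x) := by field_simp

/-- Products of summable nonnegative functions of the coordinates are summable. -/
lemma Summable.prod_coord_of_nonneg {ι α : Type*} [Fintype ι] {f : ι → α → ℝ}
    (hf : ∀ i a, 0 ≤ f i a) (hs : ∀ i, Summable (f i)) :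
    Summable fun m : ι → α => ∏ i, f i (m i) := by
  classical
  refine summable_of_sum_le (c := ∏ i, ∑' a, f i a)
    (fun m => Finset.prod_nonneg fun i _ => hf i (m i)) fun s => ?_
  calc ∑ m ∈ s, ∏ i, f i (m i)
      ≤ ∑ m ∈ Fintype.piFinset fun i => s.image fun m => m i, ∏ i, f i (m i) := by
        refine Finset.sum_le_sum_of_subset_of_nonneg (fun m hm => ?_)
          fun m _ _ => Finset.prod_nonneg fun i _ => hf i (m i)
        exact Fintype.mem_piFinset.mpr fun i => Finset.mem_image_of_mem (fun m => m i) hm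
    _ = ∏ i, ∑ a ∈ s.image fun m => m i, f i a := (Finset.prod_univ_sum _ _).symm
    _ ≤ ∏ i, ∑' a, f i a :=
        Finset.prod_le_prod (fun i _ => Finset.sum_nonneg fun a _ => hf i a)
          fun i _ => (hs i).sum_le_tsum _ fun a _ => hf i a

lemma summable_exp_neg_abs_add (a : ℝ) : Summable fun n : ℤ => Real.exp (-|(n : ℝ) + a|) := by
  have h : Summable fun n : ℤ => Real.exp (-|(n : ℝ)|) := by
    apply Summable.of_nat_of_neg <;> simpa using Real.summable_exp_neg_nat
  refine (h.mul_left (Real.exp |a|)).of_nonneg_of_le (fun _ => (Real.exp_pos _).le) fun n => ?_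
  rw [← Real.exp_add, Real.exp_le_exp]
  have := abs_sub ((n : ℝ) + a) a
  rw [add_sub_cancel_right] at this
  linarith

lemma summable_exp_neg_sum_abs_add {ι : Type*} [Fintype ι] (a : ι → ℝ) :
    Summable fun m : ι → ℤ => Real.exp (-∑ i, |(m i : ℝ) + a i|) := by
  simp_rw [← Finset.sum_neg_distrib, Real.exp_sum]
  exact Summable.prod_coord_of_nonneg (f := fun i (n : ℤ) => Real.exp (-|(n : ℝ) + a i|))
    (fun _ _ => (Real.exp_pos _).le) fun i => summable_exp_neg_abs_add (a i)

lemma norm_thetaTerm (g : ℕ) (ε δ : Fin g → ℤ) (τ : Matrix (Fin g) (Fin g) ℂ)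
    (z : Fin g → ℂ) (m : Fin g → ℤ) :
    ‖thetaTerm g ε δ τ z m‖ = Real.exp (-Real.pi *
      ((fun i => (m i : ℝ) + (ε i : ℝ) / 2) ⬝ᵥ
          ((Matrix.of fun i j => (τ i j).im) *ᵥ fun i => (m i : ℝ) + (ε i : ℝ) / 2)
        + 2 * ((fun i => (m i : ℝ) + (ε i : ℝ) / 2) ⬝ᵥ fun i => (z i).im))) := by
  have hx (i : Fin g) : (m i : ℂ) + (ε i : ℂ) / 2 = (((m i : ℝ) + (ε i : ℝ) / 2 : ℝ) : ℂ) := by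
    push_cast
    rfl
  have hδ (i : Fin g) : (z i + (δ i : ℂ) / 2).im = (z i).im := by
    rw [show (δ i : ℂ) / 2 = (((δ i : ℝ) / 2 : ℝ) : ℂ) by push_cast; rfl]
    simp
  rw [thetaTerm, Complex.norm_exp, mul_assoc, Complex.re_ofReal_mul, Complex.I_mul_re]
  simp only [hx, dotProduct, mulVec, Complex.add_im, Complex.im_sum, Complex.mul_im,
    Complex.ofReal_re, Complex.ofReal_im, Complex.re_ofNat, Complex.im_ofNat, of_apply, hδ,
    zero_mul, mul_zero, add_zero, zero_add]
  ring_nf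

lemma abs_dotProduct_le_norm_mul_sum_norm {ι : Type*} [Fintype ι] (x y : ι → ℝ) :
    |x ⬝ᵥ y| ≤ ‖x‖ * ∑ i, |y i| := by
  rw [dotProduct, Finset.mul_sum]
  refine (Finset.abs_sum_le_sum_abs _ _).trans (Finset.sum_le_sum fun i _ => ?_)
  rw [abs_mul]
  gcongr
  exact norm_le_pi_norm x i

/-- For `z` with bounded imaginary part, the general term of the theta series is at most a constant
times `exp (-‖x‖) * exp (-∑ i, |x i|)`, where `x = m + ε / 2`. -/
lemma exists_norm_thetaTerm_le (g : ℕ) (ε δ : Fin g → ℤ) (τ : Matrix (Fin g) (Fin g) ℂ)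
    (hτ : (Matrix.of fun i j => (τ i j).im : Matrix (Fin g) (Fin g) ℝ).PosDef) (S : ℝ) :
    ∃ C : ℝ, 0 ≤ C ∧ ∀ (z : Fin g → ℂ) (m : Fin g → ℤ), ∑ i, |(z i).im| ≤ S →
      ‖thetaTerm g ε δ τ z m‖ ≤ C * (Real.exp (-‖fun i => (m i : ℝ) + (ε i : ℝ) / 2‖) *
        Real.exp (-∑ i, |(m i : ℝ) + (ε i : ℝ) / 2|)) := by
  obtain ⟨c, hc, hle⟩ := hτ.exists_mul_sq_norm_le
  set B : ℝ := 2 * Real.pi * S + 1 + g with hB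
  refine ⟨Real.exp (B ^ 2 / (4 * (Real.pi * c))), (Real.exp_pos _).le, fun z m hz => ?_⟩
  rw [norm_thetaTerm, ← Real.exp_add, ← Real.exp_add, Real.exp_le_exp]
  have hquad := hle fun i => (m i : ℝ) + (ε i : ℝ) / 2
  have hlin := abs_dotProduct_le_norm_mul_sum_norm (fun i => (m i : ℝ) + (ε i : ℝ) / 2)
    fun i => (z i).im
  have hsum : ∑ i, |(m i : ℝ) + (ε i : ℝ) / 2| ≤ g * ‖fun i => (m i : ℝ) + (ε i : ℝ) / 2‖ := by
    refine (Finset.sum_le_card_nsmul _ _ _ fun i _ =>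
      norm_le_pi_norm (fun i => (m i : ℝ) + (ε i : ℝ) / 2) i).trans ?_
    simp
  set x : Fin g → ℝ := fun i => (m i : ℝ) + (ε i : ℝ) / 2
  have hlin' : -(‖x‖ * S) ≤ x ⬝ᵥ fun i => (z i).im :=
    (neg_le_neg (hlin.trans (by gcongr))).trans (neg_abs_le _)
  have hpc : 0 < Real.pi * c := mul_pos Real.pi_pos hc
  have hsq : B * ‖x‖ - Real.pi * c * ‖x‖ ^ 2 ≤ B ^ 2 / (4 * (Real.pi * c)) := by
    rw [le_div_iff₀ (by positivity)]
    nlinarith [sq_nonneg (2 * (Real.pi * c) * ‖x‖ - B)]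
  have hmul := mul_le_mul_of_nonneg_left
    (add_le_add hquad (mul_le_mul_of_nonneg_left hlin' zero_le_two)) Real.pi_pos.le
  rw [hB] at hsq
  linarith

lemma hasDerivAt_thetaTerm_coord (g : ℕ) (ε δ : Fin g → ℤ) (τ : Matrix (Fin g) (Fin g) ℂ)
    (z : Fin g → ℂ) (m : Fin g → ℤ) (j : Fin g) (t : ℂ) :
    HasDerivAt (fun t : ℂ => thetaTerm g ε δ τ (z + t • (Pi.single j 1 : Fin g → ℂ)) m)
      (2 * (Real.pi : ℂ) * Complex.I * ((m j : ℂ) + (ε j : ℂ) / 2) *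
        thetaTerm g ε δ τ (z + t • (Pi.single j 1 : Fin g → ℂ)) m) t := by
  have hdot (t : ℂ) : ((fun i => (m i : ℂ) + (ε i : ℂ) / 2) ⬝ᵥ
      fun i => (z + t • (Pi.single j 1 : Fin g → ℂ)) i + (δ i : ℂ) / 2) =
      ((fun i => (m i : ℂ) + (ε i : ℂ) / 2) ⬝ᵥ fun i => z i + (δ i : ℂ) / 2) +
        t * ((m j : ℂ) + (ε j : ℂ) / 2) := by
    rw [show (fun i => (z + t • (Pi.single j 1 : Fin g → ℂ)) i + (δ i : ℂ) / 2) =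
        (fun i => z i + (δ i : ℂ) / 2) + t • (Pi.single j 1 : Fin g → ℂ) by
      ext i
      simp only [Pi.add_apply]
      ring]
    rw [dotProduct_add, dotProduct_smul, dotProduct_single_one, smul_eq_mul]
  simp only [thetaTerm, hdot]
  refine ((((((hasDerivAt_id t).mul_const ((m j : ℂ) + (ε j : ℂ) / 2)).const_add
    _).const_mul 2).const_add _).const_mul ((Real.pi : ℂ) * Complex.I)).cexp.congr_deriv ?_
  simp only [id]
  ring

/-- for `τ` in the Siegel upper half-space, the function
`t ↦ θ[ε,δ](τ, z + t·e_j)` is differentiable at `0` with derivative the termwise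
differentiated series `∑_{m} 2πi·(m+ε/2)_j · exp(πi·((m+ε/2)·(τ(m+ε/2)) + 2(m+ε/2)·(z+δ/2)))`. -/
theorem thetaChar_hasDerivAt_coord (g : ℕ) (hg : 1 ≤ g) (τ : Matrix (Fin g) (Fin g) ℂ)
    (hτsymm : τ.IsSymm)
    (hτ : (Matrix.of fun i j => (τ i j).im : Matrix (Fin g) (Fin g) ℝ).PosDef)
    (z : Fin g → ℂ) (ε δ : Fin g → ℤ) (j : Fin g) :
    HasDerivAt (fun t : ℂ => thetaChar g ε δ τ (z + t • (Pi.single j 1 : Fin g → ℂ)))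
      (∑' m : Fin g → ℤ,
        2 * (Real.pi : ℂ) * Complex.I * ((m j : ℂ) + (ε j : ℂ) / 2) * thetaTerm g ε δ τ z m)
      0 := by
  obtain ⟨C, hC, hbound⟩ := exists_norm_thetaTerm_le g ε δ τ hτ (∑ i, |(z i).im| + 1)
  have hsummable := summable_exp_neg_sum_abs_add fun i => (ε i : ℝ) / 2
  have him (t : ℂ) (ht : t ∈ Metric.ball (0 : ℂ) 1) :
      ∑ i, |((z + t • (Pi.single j 1 : Fin g → ℂ)) i).im| ≤ ∑ i, |(z i).im| + 1 := by
    have hsingle : ∑ i, ‖(t • (Pi.single j 1 : Fin g → ℂ)) i‖ = ‖t‖ := by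
      rw [Finset.sum_eq_single j (fun i _ hij => by simp [hij]) (by simp)]
      simp
    calc ∑ i, |((z + t • (Pi.single j 1 : Fin g → ℂ)) i).im|
        ≤ ∑ i, (|(z i).im| + ‖(t • (Pi.single j 1 : Fin g → ℂ)) i‖) := by
          refine Finset.sum_le_sum fun i _ => ?_
          rw [Pi.add_apply, Complex.add_im]
          exact (abs_add_le _ _).trans (add_le_add_right (Complex.abs_im_le_norm _) _)
      _ ≤ ∑ i, |(z i).im| + 1 := by
          rw [Finset.sum_add_distrib, hsingle]
          gcongr
          exact (mem_ball_zero_iff.mp ht).le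
  have h0 : (0 : ℂ) ∈ Metric.ball (0 : ℂ) 1 := Metric.mem_ball_self one_pos
  have key := hasDerivAt_tsum_of_isPreconnected (hsummable.mul_left (2 * Real.pi * C))
    Metric.isOpen_ball (convex_ball (0 : ℂ) 1).isPreconnected
    (fun m t _ => hasDerivAt_thetaTerm_coord g ε δ τ z m j t) (fun m t ht => ?_) h0
    ((hsummable.mul_left C).of_norm_bounded fun m => ?_) h0
  · simpa only [zero_smul, add_zero] using! key
  · have hj : ‖(m j : ℂ) + (ε j : ℂ) / 2‖ ≤ ‖fun i => (m i : ℝ) + (ε i : ℝ) / 2‖ := by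
      have := norm_le_pi_norm (fun i => (m i : ℝ) + (ε i : ℝ) / 2) j
      rw [← Complex.norm_real] at this
      simpa using this
    set r := ‖fun i => (m i : ℝ) + (ε i : ℝ) / 2‖
    have hr : r * Real.exp (-r) ≤ 1 := by
      rw [Real.exp_neg, ← div_eq_mul_inv, div_le_one (Real.exp_pos _)]
      linarith [Real.add_one_le_exp r]
    rw [norm_mul, norm_mul]
    calc ‖2 * (Real.pi : ℂ) * Complex.I‖ * ‖(m j : ℂ) + (ε j : ℂ) / 2‖ *
          ‖thetaTerm g ε δ τ (z + t • (Pi.single j 1 : Fin g → ℂ)) m‖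
        ≤ (2 * Real.pi) * r *
          (C * (Real.exp (-r) * Real.exp (-∑ i, |(m i : ℝ) + (ε i : ℝ) / 2|))) := by
          gcongr
          · simp [abs_of_pos Real.pi_pos]
          · exact hbound _ m (him t ht)
      _ = 2 * Real.pi * C * Real.exp (-∑ i, |(m i : ℝ) + (ε i : ℝ) / 2|) *
          (r * Real.exp (-r)) := by ring
      _ ≤ 2 * Real.pi * C * Real.exp (-∑ i, |(m i : ℝ) + (ε i : ℝ) / 2|) :=
          mul_le_of_le_one_right (by positivity) hr
  · refine (hbound _ m (him 0 h0)).trans (mul_le_mul_of_nonneg_left ?_ hC)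
    exact mul_le_of_le_one_left (Real.exp_pos _).le
      (Real.exp_le_one_iff.mpr (neg_nonpos.mpr (norm_nonneg _)))
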